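/- arXiv:2202.09753 — 2 statements merged into one kernel-verified Lean document; each statement's English description precedes it below -/
import Mathlib

section
/- Minorization of the smoothing kernel: Suppose the FSC π* satisfies persistence of excitation with constant α ∈ (0,1) and reference measure μ̄ (Condition 1) and the minorization–majorization condition with constants ε₀ ∈ (0,1), m₀ ≥ 1 and ν ∈ ρ(X×Y^{m₀}×U^{m₀}) (Condition 2). Let n = λ m₀ and for ℓ ∈ {0,1,…,λ−1} define the smoothing kernel κ_{ℓ|n}^{m₀}(x_{(ℓ+1)m₀} | x_{ℓm₀}) = P(x_{(ℓ+1)m₀} | x_{ℓm₀}, h_n). Then for every ℓ ∈ {0,…,λ−1} and every history h_n (of positive probability under π*), there exists a probability distribution ν_{ℓ|n} ∈ ρ(X), depending on h_n but not on x_{ℓm₀}, such that κ_{ℓ|n}^{m₀}(x' | x) ≥ α^{2m₀−2} · ε₀² · ν_{ℓ|n}(x') for all x, x' ∈ X. -/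
noncomputable section

open scoped BigOperators

variable {X Y Z U : Type*} [DecidableEq X]

/-- Total variation distance between (sub)probability mass functions. -/
def dTV (p q : X → ℝ) : ℝ := (∑' x, |p x - q x|) / 2

/-- `p` is a probability mass function. -/
def IsPmf (p : X → ℝ) : Prop := (∀ x, 0 ≤ p x) ∧ ∑' x, p x = 1

/-- Tail of a finite tuple. -/
def finTail {m : ℕ} {A : Type*} (f : Fin (m + 1) → A) : Fin m → A := fun i => f i.succ

/-- Last entry of a finite tuple (or the given default for the empty tuple). -/
def lastF {A : Type*} (a : A) : {m : ℕ} → (Fin m → A) → A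
  | 0, _ => a
  | _ + 1, f => f (Fin.last _)

/-- `blockProb P Φ pol φd m x y z ys us x'` is the conditional probability
`P(x_m = x', y_1^m = ys, u_0^{m−1} = us | x_0 = x, y_0 = y, z_0 = z)` under the
finite-state controller `pol` with deterministic internal-state update `φd`:
`∑_{x_1^{m−1}} ∏_j pol(u_j|y_j,z_j) P(x_{j+1}|x_j,u_j) Φ(y_{j+1}|x_{j+1})`. -/
def blockProb (P : X → U → X → ℝ) (Φ : X → Y → ℝ) (pol : Y → Z → U → ℝ)
    (φd : Z → Y → U → Z) : (m : ℕ) → X → Y → Z → (Fin m → Y) → (Fin m → U) → X → ℝ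
  | 0, x, _, _, _, _, x' => if x' = x then 1 else 0
  | m + 1, x, y, z, ys, us, x' =>
      ∑' x1 : X, pol y z (us 0) * P x (us 0) x1 * Φ x1 (ys 0) *
        blockProb P Φ pol φd m x1 (ys 0) (φd z y (us 0)) (finTail ys) (finTail us) x'

/-- Same as `blockProb` but marginalized over the final hidden state:
`P̄`-type block probability with a memoryless action distribution `μ̄`. -/
def barBlock (P : X → U → X → ℝ) (Φ : X → Y → ℝ) (μ : U → ℝ) :
    (m : ℕ) → X → (Fin m → Y) → (Fin m → U) → X → ℝ
  | 0, x, _, _, x' => if x' = x then 1 else 0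
  | m + 1, x, ys, us, x' =>
      ∑' x1 : X, μ (us 0) * P x (us 0) x1 * Φ x1 (ys 0) *
        barBlock P Φ μ m x1 (finTail ys) (finTail us) x'

/-- Backward variable: `backward P Φ pol φd m x y z ys us` is
`P(y_1^m = ys, u_0^{m−1} = us | x_0 = x, y_0 = y, z_0 = z)` under the FSC `pol`
with deterministic internal-state update `φd`. -/
def backward (P : X → U → X → ℝ) (Φ : X → Y → ℝ) (pol : Y → Z → U → ℝ)
    (φd : Z → Y → U → Z) : (m : ℕ) → X → Y → Z → (Fin m → Y) → (Fin m → U) → ℝ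
  | 0, _, _, _, _, _ => 1
  | m + 1, x, y, z, ys, us =>
      pol y z (us 0) * ∑' x1 : X, P x (us 0) x1 * Φ x1 (ys 0) *
        backward P Φ pol φd m x1 (ys 0) (φd z y (us 0)) (finTail ys) (finTail us)

/-- Internal state after `m` steps of the deterministic update `φd`. -/
def zAfter (φd : Z → Y → U → Z) : (m : ℕ) → Z → Y → (Fin m → Y) → (Fin m → U) → Z
  | 0, z, _, _, _ => z
  | m + 1, z, y, ys, us => zAfter φd m (φd z y (us 0)) (ys 0) (finTail ys) (finTail us)

/-- One step of the Bayes filter: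
`F(b,y,u)(x) = ∑_{x'} b(x') P(x|x',u) Φ(y|x) / normalizer`. -/
def bayesF (P : X → U → X → ℝ) (Φ : X → Y → ℝ) (b : X → ℝ) (y : Y) (u : U) : X → ℝ :=
  fun x => (∑' x' : X, b x' * P x' u x * Φ x y) /
    ∑' x'' : X, ∑' x' : X, b x' * P x' u x'' * Φ x'' y

/-- `n`-fold application of the Bayes filter along observations `ys` and
actions `us`. -/
def bayesFilter (P : X → U → X → ℝ) (Φ : X → Y → ℝ) :
    (n : ℕ) → (X → ℝ) → (Fin n → Y) → (Fin n → U) → (X → ℝ)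
  | 0, b, _, _ => b
  | n + 1, b, ys, us => bayesFilter P Φ n (bayesF P Φ b (ys 0) (us 0)) (finTail ys) (finTail us)


/-- The smoothing kernel `κ_{ℓ|n}^{m}(x'|x) = P(x_{ℓm+m} = x' | x_{ℓm} = x, h_n)`.
The realized history `h_n` enters through the current observation `y` and
internal state `z` at time `ℓm`, the next block `(ys₁, us₁)` of `m`
observation/action pairs, and the remaining tail `(ys₂, us₂)` of length `k`. -/
def smoothKernel {X Y Z U : Type*} [DecidableEq X]
    (P : X → U → X → ℝ) (Φ : X → Y → ℝ) (pol : Y → Z → U → ℝ) (φd : Z → Y → U → Z)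
    (m k : ℕ) (x : X) (y : Y) (z : Z) (ys1 : Fin m → Y) (us1 : Fin m → U)
    (ys2 : Fin k → Y) (us2 : Fin k → U) (x' : X) : ℝ :=
  blockProb P Φ pol φd m x y z ys1 us1 x' *
      backward P Φ pol φd k x' (lastF y ys1) (zAfter φd m z y ys1 us1) ys2 us2 /
    ∑' x'' : X, blockProb P Φ pol φd m x y z ys1 us1 x'' *
      backward P Φ pol φd k x'' (lastF y ys1) (zAfter φd m z y ys1 us1) ys2 us2

/-- Along a fixed history, the block probability under the controller is a state-independent
multiple of the block probability under the reference action distribution. -/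
theorem exists_blockProb_eq_mul_barBlock
    (P : X → U → X → ℝ) (Φ : X → Y → ℝ) (pol : Y → Z → U → ℝ) (φd : Z → Y → U → Z) (μ : U → ℝ)
    (hpol : ∀ y z u, 0 ≤ pol y z u) (hμ : ∀ u, 0 ≤ μ u)
    (hac : ∀ y z u, μ u = 0 → pol y z u = 0)
    (m : ℕ) (y : Y) (z : Z) (ys : Fin m → Y) (us : Fin m → U) :
    ∃ r : ℝ, 0 ≤ r ∧ ∀ x x',
      blockProb P Φ pol φd m x y z ys us x' = r * barBlock P Φ μ m x ys us x' := by
  induction m generalizing y z with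
  | zero => exact ⟨1, zero_le_one, fun x x' => by simp [blockProb, barBlock]⟩
  | succ m ih =>
    obtain ⟨r, hr, h⟩ := ih (ys 0) (φd z y (us 0)) (finTail ys) (finTail us)
    refine ⟨pol y z (us 0) / μ (us 0) * r,
      mul_nonneg (div_nonneg (hpol _ _ _) (hμ _)) hr, fun x x' => ?_⟩
    have hq : pol y z (us 0) / μ (us 0) * μ (us 0) = pol y z (us 0) :=
      div_mul_cancel_of_imp (hac _ _ _)
    rw [blockProb, barBlock, ← tsum_mul_left]
    refine tsum_congr fun x1 => ?_
    rw [h]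
    nth_rw 1 [← hq]
    generalize pol y z (us 0) / μ (us 0) = q
    ring

theorem backward_nonneg {X Y Z U : Type*}
    {P : X → U → X → ℝ} {Φ : X → Y → ℝ} {pol : Y → Z → U → ℝ} {φd : Z → Y → U → Z}
    (hP : ∀ x u x', 0 ≤ P x u x') (hΦ : ∀ x y, 0 ≤ Φ x y) (hpol : ∀ y z u, 0 ≤ pol y z u)
    (m : ℕ) (x : X) (y : Y) (z : Z) (ys : Fin m → Y) (us : Fin m → U) :
    0 ≤ backward P Φ pol φd m x y z ys us := by
  induction m generalizing x y z with
  | zero => exact zero_le_one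
  | succ m ih =>
    exact mul_nonneg (hpol _ _ _)
      (tsum_nonneg fun x1 => mul_nonneg (mul_nonneg (hP _ _ _) (hΦ _ _)) (ih _ _ _ _ _))

/-- If a family `b x` is sandwiched between `ε * v` and `v / ε`, then reweighting by `β` and
normalizing gives a family minorized by `ε ^ 2` times a common probability mass function. -/
theorem exists_isPmf_minorization {ι X : Type*} [Nonempty ι]
    {b : ι → X → ℝ} {v β : X → ℝ} {ε : ℝ}
    (hε : 0 < ε) (hv : ∀ x, 0 ≤ v x) (hβ : ∀ x, 0 ≤ β x)
    (hlow : ∀ i x, ε * v x ≤ b i x) (hupp : ∀ i x, b i x ≤ v x / ε)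
    (hpos : ∀ i, 0 < ∑' x, b i x * β x) :
    ∃ p : X → ℝ, IsPmf p ∧ ∀ i x, ε ^ 2 * p x ≤ b i x * β x / ∑' x', b i x' * β x' := by
  have hbsum (i : ι) : Summable fun x => b i x * β x := by
    by_contra h
    exact (hpos i).ne' (tsum_eq_zero_of_not_summable h)
  have hvβ (x : X) : 0 ≤ v x * β x := mul_nonneg (hv x) (hβ x)
  have hvsum : Summable fun x => v x * β x := by
    obtain ⟨i⟩ := ‹Nonempty ι›
    refine Summable.of_nonneg_of_le hvβ (fun x => ?_) ((hbsum i).mul_left ε⁻¹)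
    rw [← mul_assoc]
    refine mul_le_mul_of_nonneg_right ?_ (hβ x)
    rw [inv_mul_eq_div, le_div_iff₀' hε]
    exact hlow i x
  have hle (i : ι) : ∑' x, b i x * β x ≤ (∑' x, v x * β x) / ε := by
    rw [← tsum_div_const]
    refine (hbsum i).tsum_le_tsum (fun x => ?_) (hvsum.div_const ε)
    rw [mul_div_right_comm]
    exact mul_le_mul_of_nonneg_right (hupp i x) (hβ x)
  have hS : 0 < ∑' x, v x * β x := by
    obtain ⟨i⟩ := ‹Nonempty ι›
    exact (div_pos_iff_of_pos_right hε).1 ((hpos i).trans_le (hle i))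
  refine ⟨fun x => v x * β x / ∑' x', v x' * β x', ⟨fun x => div_nonneg (hvβ x) hS.le, ?_⟩,
    fun i x => ?_⟩
  · rw [tsum_div_const, div_self hS.ne']
  · calc ε ^ 2 * (v x * β x / ∑' x', v x' * β x')
        = ε * v x * β x / ((∑' x', v x' * β x') / ε) := by field_simp
      _ ≤ b i x * β x / ∑' x', b i x' * β x' :=
        div_le_div₀ (mul_nonneg ((mul_nonneg hε.le (hv x)).trans (hlow i x)) (hβ x))
          (mul_le_mul_of_nonneg_right (hlow i x) (hβ x)) (hpos i) (hle i)

/-- **Minorization of the smoothing kernel.** Under persistence of excitation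
(Condition 1) and minorization–majorization (Condition 2), for every block
index and every realized history of positive probability there is a
probability distribution `ν_{ℓ|n}` on `X`, depending on the history but not on
the conditioning state, such that
`κ_{ℓ|n}^{m₀}(x'|x) ≥ α^{2m₀−2} ε₀² ν_{ℓ|n}(x')` for all `x, x'`. -/
theorem smoothing_kernel_minorization
    {X Y Z U : Type*} [DecidableEq X] [Countable X] [Countable Y] [Finite Z] [Finite U]
    (P : X → U → X → ℝ) (Φ : X → Y → ℝ)
    (hP : ∀ x u, IsPmf (P x u)) (hΦ : ∀ x, IsPmf (Φ x))
    (polStar : Y → Z → U → ℝ) (hpol : ∀ y z, IsPmf (polStar y z))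
    (φd : Z → Y → U → Z)
    (α ε₀ : ℝ) (hα : α ∈ Set.Ioo (0 : ℝ) 1) (hε₀ : ε₀ ∈ Set.Ioo (0 : ℝ) 1)
    (m₀ : ℕ) (hm₀ : 1 ≤ m₀)
    (μbar : U → ℝ) (hμbar : IsPmf μbar)
    -- Condition 1 (persistence of excitation):
    (hPE : ∀ (u : U) (y : Y) (z : Z),
      α * μbar u ≤ polStar y z u ∧ polStar y z u ≤ μbar u / α)
    (ν : X × (Fin m₀ → Y) × (Fin m₀ → U) → ℝ) (hν : IsPmf ν)
    -- Condition 2 (minorization–majorization):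
    (hMM : ∀ (x₀ xm : X) (ys : Fin m₀ → Y) (us : Fin m₀ → U),
      ε₀ * ν (xm, ys, us) ≤ barBlock P Φ μbar m₀ x₀ ys us xm ∧
        barBlock P Φ μbar m₀ x₀ ys us xm ≤ ν (xm, ys, us) / ε₀)
    -- the pieces of the realized history `h_n`:
    (y : Y) (z : Z) (ys1 : Fin m₀ → Y) (us1 : Fin m₀ → U)
    (k : ℕ) (ys2 : Fin k → Y) (us2 : Fin k → U)
    -- the realized history has positive probability:
    (hpos : ∀ x : X,
      0 < ∑' x'' : X, blockProb P Φ polStar φd m₀ x y z ys1 us1 x'' *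
        backward P Φ polStar φd k x'' (lastF y ys1) (zAfter φd m₀ z y ys1 us1) ys2 us2) :
    ∃ νl : X → ℝ, IsPmf νl ∧
      ∀ x x' : X,
        α ^ (2 * m₀ - 2) * ε₀ ^ 2 * νl x'
          ≤ smoothKernel P Φ polStar φd m₀ k x y z ys1 us1 ys2 us2 x' := by
  have hac (y : Y) (z : Z) (u : U) (hu : μbar u = 0) : polStar y z u = 0 :=
    le_antisymm (by simpa [hu] using (hPE u y z).2) ((hpol y z).1 u)
  obtain ⟨r, hr, hblock⟩ := exists_blockProb_eq_mul_barBlock P Φ polStar φd μbar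
    (fun y z => (hpol y z).1) hμbar.1 hac m₀ y z ys1 us1
  have hX : Nonempty X := by
    by_contra h
    rw [not_nonempty_iff] at h
    simpa using hν.2
  set β : X → ℝ := fun x =>
    backward P Φ polStar φd k x (lastF y ys1) (zAfter φd m₀ z y ys1 us1) ys2 us2
  have hsum (x : X) : ∑' x'', blockProb P Φ polStar φd m₀ x y z ys1 us1 x'' * β x'' =
      r * ∑' x'', barBlock P Φ μbar m₀ x ys1 us1 x'' * β x'' := by
    simp only [hblock, mul_assoc, tsum_mul_left]
  have hrpos (x : X) : 0 < r * ∑' x'', barBlock P Φ μbar m₀ x ys1 us1 x'' * β x'' :=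
    hsum x ▸ hpos x
  have hr₀ : r ≠ 0 := left_ne_zero_of_mul (hrpos hX.some).ne'
  obtain ⟨p, hp, hmin⟩ := exists_isPmf_minorization
    (b := fun x x' => barBlock P Φ μbar m₀ x ys1 us1 x') (v := fun x => ν (x, ys1, us1)) (β := β)
    hε₀.1 (fun x => hν.1 _)
    (fun x => backward_nonneg (fun x u => (hP x u).1) (fun x => (hΦ x).1)
      (fun y z => (hpol y z).1) _ _ _ _ _ _)
    (fun x x' => (hMM x x' ys1 us1).1) (fun x x' => (hMM x x' ys1 us1).2)
    (fun x => pos_of_mul_pos_right (hrpos x) hr)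
  refine ⟨p, hp, fun x x' => ?_⟩
  have hκ : smoothKernel P Φ polStar φd m₀ k x y z ys1 us1 ys2 us2 x' =
      barBlock P Φ μbar m₀ x ys1 us1 x' * β x' /
        ∑' x'', barBlock P Φ μbar m₀ x ys1 us1 x'' * β x'' := by
    change blockProb P Φ polStar φd m₀ x y z ys1 us1 x' * β x' /
      (∑' x'', blockProb P Φ polStar φd m₀ x y z ys1 us1 x'' * β x'') = _
    rw [hsum, hblock, mul_assoc, mul_div_mul_left _ _ hr₀]
  rw [hκ, mul_assoc]
  exact (mul_le_of_le_one_left (mul_nonneg (sq_nonneg _) (hp.1 x'))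
    (pow_le_one₀ hα.1.le hα.2.le)).trans (hmin x x')
end
end

section
/- Geometric filter stability for POMDPs under an FSC: Suppose the FSC π* satisfies persistence of excitation with constant α ∈ (0,1) and the minorization–majorization condition with constants ε₀ ∈ (0,1) and m₀ ≥ 1 (Conditions 1–2). Then for any two prior distributions v₀, v₀' ∈ ρ(X), any n ≥ 1, and any realized observation–action history h_n = (h_0, y_1^n, u^{n−1}) of positive probability under π*: d_TV(F^{(n)}(v₀, y_1^n, u_0^{n−1}), F^{(n)}(v₀', y_1^n, u_0^{n−1})) ≤ (1 − (ε₀ α^{m₀−1})²)^{⌊n/m₀⌋} · d_TV(φ(v₀, h_n), φ(v₀', h_n)) ≤ (1 − (ε₀ α^{m₀−1})²)^{⌊n/m₀⌋}, where φ(v₀, h_n)(x) = v₀(x) β_{0|n}(x, h_0; y_1^n, u^{n−1}) / ∑_{x'} v₀(x') β_{0|n}(x', h_0; y_1^n, u^{n−1}) is the posterior of x_0 given h_n when the prior is v₀, and β_{0|n}(x, h_0; y_1^n, u^{n−1}) = P(y_1^n, u^{n−1} | x_0 = x, h_0). -/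
noncomputable section

open scoped BigOperators

variable {X Y Z U : Type*} [DecidableEq X]

/-- Posterior of the initial hidden state given the realized history:
`φ(v₀,h_n)(x) = v₀(x) β_{0|n}(x,h₀;y_1^n,u^{n−1}) / ∑_{x'} v₀(x') β_{0|n}(x',…)`. -/
def initialPosterior {X Y Z U : Type*}
    (P : X → U → X → ℝ) (Φ : X → Y → ℝ) (pol : Y → Z → U → ℝ) (φd : Z → Y → U → Z)
    (n : ℕ) (v : X → ℝ) (y₀ : Y) (z₀ : Z) (ys : Fin n → Y) (us : Fin n → U) : X → ℝ :=
  fun x => v x * backward P Φ pol φd n x y₀ z₀ ys us /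
    ∑' x' : X, v x' * backward P Φ pol φd n x' y₀ z₀ ys us

/-- Nonnegative kernels all of whose rows have total mass at most one. -/
structure IsSubstochastic (k : X → X → ℝ) : Prop where
  nonneg : ∀ x x', 0 ≤ k x x'
  summable : ∀ x, Summable (k x)
  tsum_le_one : ∀ x, ∑' x', k x x' ≤ 1

/-- Push-forward of a signed mass function by a kernel. -/
def kernelPush (g : X → ℝ) (k : X → X → ℝ) : X → ℝ := fun x' => ∑' x, g x * k x x'

/-- Action of a kernel on functions. -/
def kernelPull (k : X → X → ℝ) (f : X → ℝ) : X → ℝ := fun x => ∑' x', k x x' * f x'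

/-- Composition of the first `n` kernels of a sequence. -/
def kernelIter (K : ℕ → X → X → ℝ) : ℕ → X → X → ℝ
  | 0 => fun x x' => if x' = x then 1 else 0
  | n + 1 => fun x => kernelPush (K 0 x) (kernelIter (fun i => K (i + 1)) n)

/-- Unnormalized one-step filter kernel. -/
def filterKernel (P : X → U → X → ℝ) (Φ : X → Y → ℝ) (y : Y) (u : U) : X → X → ℝ :=
  fun x x' => P x u x' * Φ x' y

namespace IsSubstochastic

variable {S : Type*} {k : S → S → ℝ}

lemma le_one (hk : IsSubstochastic k) (x x' : S) : k x x' ≤ 1 :=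
  ((hk.summable x).le_tsum x' fun _ _ => hk.nonneg x _).trans (hk.tsum_le_one x)

lemma summable_mul (hk : IsSubstochastic k) {f : S → ℝ} {C : ℝ} (hf : ∀ x, |f x| ≤ C) (x : S) :
    Summable fun x' => k x x' * f x' := by
  refine Summable.of_norm_bounded ((hk.summable x).mul_right C) fun x' => ?_
  rw [norm_mul, Real.norm_of_nonneg (hk.nonneg x x')]
  exact mul_le_mul_of_nonneg_left (hf x') (hk.nonneg x x')

lemma summable_prod (hk : IsSubstochastic k) {g f : S → ℝ} {C : ℝ} (hg : Summable g)
    (hf : ∀ x, |f x| ≤ C) : Summable fun p : S × S => g p.1 * k p.1 p.2 * f p.2 := by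
  have hs : ∀ x, Summable fun x' => k x x' * |f x'| := fun x =>
    hk.summable_mul (f := fun x' => |f x'|) (by simpa using hf) x
  have h₀ : ∀ x x', 0 ≤ |g x| * (k x x' * |f x'|) := fun x x' =>
    mul_nonneg (abs_nonneg _) (mul_nonneg (hk.nonneg _ _) (abs_nonneg _))
  have hle : ∀ x, ∑' x', |g x| * (k x x' * |f x'|) ≤ |g x| * C := fun x => by
    have hC : 0 ≤ C := (abs_nonneg _).trans (hf x)
    rw [tsum_mul_left]
    refine mul_le_mul_of_nonneg_left ?_ (abs_nonneg _)
    calc ∑' x', k x x' * |f x'| ≤ ∑' x', k x x' * C :=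
          (hs x).tsum_le_tsum (fun x' => mul_le_mul_of_nonneg_left (hf x') (hk.nonneg x x'))
            ((hk.summable x).mul_right C)
      _ = (∑' x', k x x') * C := tsum_mul_right
      _ ≤ C := mul_le_of_le_one_left hC (hk.tsum_le_one x)
  have h : Summable fun p : S × S => |g p.1| * (k p.1 p.2 * |f p.2|) :=
    (summable_prod_of_nonneg fun p => h₀ p.1 p.2).mpr ⟨fun x => (hs x).mul_left |g x|,
      Summable.of_nonneg_of_le (fun x => tsum_nonneg (h₀ x)) hle (hg.abs.mul_right C)⟩
  refine Summable.of_norm_bounded h fun p => ?_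
  rw [norm_mul, norm_mul, Real.norm_of_nonneg (hk.nonneg _ _), mul_assoc]
  rfl

lemma tsum_push_mul (hk : IsSubstochastic k) {g f : S → ℝ} {C : ℝ} (hg : Summable g)
    (hf : ∀ x, |f x| ≤ C) :
    ∑' x', kernelPush g k x' * f x' = ∑' x, g x * kernelPull k f x := by
  have h := hk.summable_prod hg hf
  calc ∑' x', kernelPush g k x' * f x' = ∑' x', ∑' x, g x * k x x' * f x' :=
        tsum_congr fun x' => tsum_mul_right.symm
    _ = ∑' x, ∑' x', g x * k x x' * f x' :=
        Summable.tsum_comm (f := fun x x' => g x * k x x' * f x') h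
    _ = ∑' x, g x * kernelPull k f x := tsum_congr fun x => by
        simp only [mul_assoc, tsum_mul_left, kernelPull]

lemma summable_push (hk : IsSubstochastic k) {g : S → ℝ} (hg : Summable g) :
    Summable (kernelPush g k) := by
  have h := hk.summable_prod (f := fun _ => 1) (C := 1) hg (by simp)
  exact h.prod_symm.prod.congr fun x' => by simp [kernelPush]

lemma pull_nonneg (hk : IsSubstochastic k) {f : S → ℝ} (hf : ∀ x, 0 ≤ f x) (x : S) :
    0 ≤ kernelPull k f x := tsum_nonneg fun _ => mul_nonneg (hk.nonneg _ _) (hf _)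

lemma pull_one_le (hk : IsSubstochastic k) (x : S) : kernelPull k (fun _ => 1) x ≤ 1 := by
  simpa [kernelPull] using hk.tsum_le_one x

lemma abs_pull_one_le (hk : IsSubstochastic k) (x : S) : |kernelPull k (fun _ => 1) x| ≤ 1 := by
  rw [abs_of_nonneg (hk.pull_nonneg (fun _ => zero_le_one) x)]
  exact hk.pull_one_le x

lemma summable_mul_pull_one (hk : IsSubstochastic k) {g : S → ℝ} (hg : Summable g) :
    Summable fun x => g x * kernelPull k (fun _ => 1) x := by
  refine Summable.of_norm_bounded hg.abs fun x => ?_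
  rw [norm_mul]
  exact mul_le_of_le_one_right (norm_nonneg _) (hk.abs_pull_one_le x)

lemma push_push (hk : IsSubstochastic k) {l : S → S → ℝ} (hl : IsSubstochastic l) {g : S → ℝ}
    (hg : Summable g) :
    kernelPush (kernelPush g k) l = kernelPush g fun x => kernelPush (k x) l := by
  ext x''
  exact hk.tsum_push_mul (f := fun x => l x x'') (C := 1) hg fun x => by
    rw [abs_of_nonneg (hl.nonneg _ _)]; exact hl.le_one _ _

lemma pull_pull (hk : IsSubstochastic k) {l : S → S → ℝ} (hl : IsSubstochastic l) {f : S → ℝ}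
    {C : ℝ} (hf : ∀ x, |f x| ≤ C) :
    kernelPull k (kernelPull l f) = kernelPull (fun x => kernelPush (k x) l) f := by
  ext x
  exact (hl.tsum_push_mul (hk.summable x) hf).symm

lemma comp (hk : IsSubstochastic k) {l : S → S → ℝ} (hl : IsSubstochastic l) :
    IsSubstochastic fun x => kernelPush (k x) l where
  nonneg x x' := tsum_nonneg fun _ => mul_nonneg (hk.nonneg _ _) (hl.nonneg _ _)
  summable x := hl.summable_push (hk.summable x)
  tsum_le_one x := by
    have h := hl.tsum_push_mul (f := fun _ => 1) (C := 1) (hk.summable x) (by simp)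
    simp only [mul_one] at h
    rw [h]
    refine le_trans ((hl.summable_mul_pull_one (hk.summable x)).tsum_le_tsum (fun x' => ?_)
      (hk.summable x)) (hk.tsum_le_one x)
    exact mul_le_of_le_one_right (hk.nonneg _ _) (hl.pull_one_le x')

lemma iter {K : ℕ → X → X → ℝ} (hK : ∀ i, IsSubstochastic (K i)) (n : ℕ) :
    IsSubstochastic (kernelIter K n) := by
  induction n generalizing K with
  | zero =>
    refine ⟨fun x x' => ?_, fun x => ?_, fun x => ?_⟩
    · simp only [kernelIter]; split_ifs <;> simp
    · exact (hasSum_ite_eq x (1 : ℝ)).summable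
    · exact (tsum_ite_eq x fun _ => (1 : ℝ)).le
  | succ n ih => exact (hK 0).comp (ih fun i => hK (i + 1))

/-- The weighted `ℓ¹` norm does not increase under a push-forward. -/
lemma tsum_abs_push_mul_le (hk : IsSubstochastic k) {g f : S → ℝ} {C : ℝ} (hg : Summable g)
    (hf : ∀ x, |f x| ≤ C) (hf₀ : ∀ x, 0 ≤ f x) :
    ∑' x', |kernelPush g k x'| * f x' ≤ ∑' x, |g x| * kernelPull k f x := by
  rw [← hk.tsum_push_mul hg.abs hf]
  have hs : Summable fun x' => kernelPush (fun x => |g x|) k x' * f x' := by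
    refine (hk.summable_prod hg.abs hf).prod_symm.prod.congr fun x' => ?_
    simp only [Prod.swap, tsum_mul_right, kernelPush]
  have hle : ∀ x', |kernelPush g k x'| * f x' ≤ kernelPush (fun x => |g x|) k x' * f x' := by
    refine fun x' => mul_le_mul_of_nonneg_right ?_ (hf₀ x')
    have hb : Summable fun x => ‖g x * k x x'‖ := by
      refine Summable.of_nonneg_of_le (fun _ => norm_nonneg _) (fun x => ?_) hg.abs
      rw [norm_mul, Real.norm_of_nonneg (hk.nonneg _ _)]
      exact mul_le_of_le_one_right (abs_nonneg _) (hk.le_one _ _)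
    refine (norm_tsum_le_tsum_norm hb).trans_eq (tsum_congr fun x => ?_)
    rw [norm_mul, Real.norm_of_nonneg (hk.nonneg _ _)]
    rfl
  exact (Summable.of_nonneg_of_le (fun x' => mul_nonneg (abs_nonneg _) (hf₀ x')) hle hs).tsum_le_tsum
    hle hs

/-- Dobrushin contraction for a kernel squeezed between multiples of one mass function `w`. -/
lemma tsum_abs_push_mul_le_of_doeblin (hk : IsSubstochastic k) {w : S → ℝ} {ε : ℝ} (hε : 0 < ε)
    (hw : Summable w) (hlow : ∀ x x', ε * w x' ≤ k x x') (hup : ∀ x x', k x x' ≤ w x' / ε)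
    {g f : S → ℝ} (hg : Summable g) (hf : ∀ x, |f x| ≤ 1) (hf₀ : ∀ x, 0 ≤ f x)
    (h0 : ∑' x, g x * kernelPull k f x = 0) :
    ∑' x', |kernelPush g k x'| * f x' ≤ (1 - ε ^ 2) * ∑' x, |g x| * kernelPull k f x := by
  set β := kernelPull k f
  set N := ∑' x', w x' * f x' with hN
  have hf1 : ∀ x, f x ≤ 1 := fun x => (le_abs_self _).trans (hf x)
  have hw0 : ∀ x, 0 ≤ w x := fun x => by
    have := (hk.nonneg x x).trans (hup x x)
    by_contra hlt
    exact absurd (div_neg_of_neg_of_pos (not_le.mp hlt) hε) (not_lt.mpr this)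
  have hwf : Summable fun x' => w x' * f x' :=
    Summable.of_nonneg_of_le (fun x' => mul_nonneg (hw0 x') (hf₀ x'))
      (fun x' => mul_le_of_le_one_right (hw0 x') (hf1 x')) hw
  have hN0 : 0 ≤ N := tsum_nonneg fun x' => mul_nonneg (hw0 x') (hf₀ x')
  have hβ0 : ∀ x, 0 ≤ β x := hk.pull_nonneg hf₀
  have hβN : ∀ x, β x ≤ N / ε := fun x => by
    rw [hN, ← tsum_div_const]
    refine (hk.summable_mul hf x).tsum_le_tsum (fun x' => ?_) (hwf.div_const ε)
    calc k x x' * f x' ≤ w x' / ε * f x' := mul_le_mul_of_nonneg_right (hup x x') (hf₀ x')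
      _ = w x' * f x' / ε := by ring
  have hβw : ∀ x, ε ^ 2 * (β x / N) ≤ ε := fun x => by
    rcases hN0.eq_or_lt with h | h
    · simp [← h, hε.le]
    · have := hβN x
      rw [le_div_iff₀ hε] at this
      rw [← mul_div_assoc, div_le_iff₀ h]
      nlinarith
  have hβ1 : ∀ x, β x / N * N = β x := fun x => by
    rcases hN0.eq_or_lt with h | h
    · have := hβN x
      rw [← h, zero_div] at this
      simp [le_antisymm this (hβ0 x)]
    · exact div_mul_cancel₀ _ h.ne'
  set r : S → S → ℝ := fun x x' => k x x' - ε ^ 2 * (β x / N) * w x' with hr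
  have hcw : ∀ x x', 0 ≤ ε ^ 2 * (β x / N) * w x' := fun x x' =>
    mul_nonneg (mul_nonneg (sq_nonneg _) (div_nonneg (hβ0 x) hN0)) (hw0 x')
  have hrs : ∀ x, Summable (r x) := fun x => (hk.summable x).sub (hw.mul_left _)
  have hrk : IsSubstochastic r :=
    { nonneg := fun x x' => by
        have := mul_le_mul_of_nonneg_right (hβw x) (hw0 x')
        have := hlow x x'
        simp only [hr]
        linarith
      summable := hrs
      tsum_le_one := fun x => ((hrs x).tsum_le_tsum
        (fun x' => sub_le_self _ (hcw x x')) (hk.summable x)).trans (hk.tsum_le_one x) }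
  have hrf : ∀ x, kernelPull r f x = (1 - ε ^ 2) * β x := fun x => by
    have e : ∀ x', r x x' * f x' = k x x' * f x' - ε ^ 2 * (β x / N) * (w x' * f x') :=
      fun x' => by simp only [hr]; ring
    simp only [kernelPull, e]
    rw [(hk.summable_mul hf x).tsum_sub (hwf.mul_left _), tsum_mul_left, mul_assoc, hβ1]
    change β x - _ = _
    ring
  have hβs : Summable fun x => g x * β x := by
    refine (hk.summable_prod hg hf).prod.congr fun x => ?_
    simp only [mul_assoc, tsum_mul_left]
    rfl
  have hgr : kernelPush g r = kernelPush g k := by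
    ext x'
    have e : ∀ x, g x * r x x' = g x * k x x' - g x * β x * (ε ^ 2 / N * w x') :=
      fun x => by simp only [hr]; ring
    have hs : Summable fun x => g x * k x x' := by
      refine Summable.of_norm_bounded hg.abs fun x => ?_
      rw [norm_mul, Real.norm_of_nonneg (hk.nonneg _ _)]
      exact mul_le_of_le_one_right (norm_nonneg _) (hk.le_one _ _)
    simp only [kernelPush, e]
    rw [hs.tsum_sub (hβs.mul_right _), tsum_mul_right, h0]
    ring
  have h := hrk.tsum_abs_push_mul_le hg hf hf₀
  rw [hgr] at h
  refine h.trans_eq ?_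
  rw [← tsum_mul_left]
  exact tsum_congr fun x => by rw [hrf]; ring

end IsSubstochastic

lemma kernelPush_kernelIter_zero (K : ℕ → X → X → ℝ) (g : X → ℝ) :
    kernelPush g (kernelIter K 0) = g := by
  ext x
  simp [kernelPush, kernelIter]

lemma kernelIter_add {K : ℕ → X → X → ℝ} (hK : ∀ i, IsSubstochastic (K i)) (m n : ℕ) :
    kernelIter K (m + n) =
      fun x => kernelPush (kernelIter K m x) (kernelIter (fun i => K (i + m)) n) := by
  induction m generalizing K with
  | zero =>
    ext x x'
    simp [kernelIter, kernelPush]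
  | succ m ih =>
    rw [Nat.succ_add]
    ext1 x
    simp only [kernelIter]
    rw [ih fun i => hK (i + 1), IsSubstochastic.push_push (.iter (fun i => hK (i + 1)) m)
      (.iter (fun i => hK (i + (m + 1))) n) ((hK 0).summable x)]
    rfl

/-- Geometric contraction of signed mass functions annihilated by the backward variable. -/
lemma tsum_abs_push_iter_le {K : ℕ → X → X → ℝ} (hK : ∀ i, IsSubstochastic (K i)) {ε : ℝ}
    (hε : 0 < ε) (hε₁ : ε ≤ 1) {m : ℕ} (hm : 0 < m)
    (hD : ∀ j, ∃ w : X → ℝ, Summable w ∧ ∀ x x',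
      ε * w x' ≤ kernelIter (fun i => K (i + j)) m x x' ∧
      kernelIter (fun i => K (i + j)) m x x' ≤ w x' / ε)
    (n : ℕ) {g : X → ℝ} (hg : Summable g)
    (h0 : ∑' x, g x * kernelPull (kernelIter K n) (fun _ => 1) x = 0) :
    ∑' x, |kernelPush g (kernelIter K n) x| ≤
      (1 - ε ^ 2) ^ (n / m) * ∑' x, |g x| * kernelPull (kernelIter K n) (fun _ => 1) x := by
  induction n using Nat.strong_induction_on generalizing K g with
  | _ n ih =>
    rcases lt_or_ge n m with hnm | hnm
    · rw [Nat.div_eq_of_lt hnm, pow_zero, one_mul]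
      simpa using (IsSubstochastic.iter hK n).tsum_abs_push_mul_le (f := fun _ => 1) (C := 1) hg
        (by simp) (by simp)
    · obtain ⟨n, rfl⟩ := Nat.exists_eq_add_of_le hnm
      have hK' : ∀ i, IsSubstochastic (K (i + m)) := fun i => hK (i + m)
      have hA := IsSubstochastic.iter hK m
      have hB := IsSubstochastic.iter hK' n
      have hadd := kernelIter_add hK m n
      have hpull := hA.pull_pull hB (f := fun _ => 1) (C := 1) (by simp)
      have hpush := hA.push_push hB hg
      rw [← hadd] at hpull hpush
      rw [← hpull] at h0 ⊢
      rw [← hpush, Nat.add_div_left _ hm, pow_succ, mul_assoc]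
      have hc : 0 ≤ 1 - ε ^ 2 := by nlinarith
      refine (ih n (by omega) hK' (fun j => ?_) (hA.summable_push hg) ?_).trans
        (mul_le_mul_of_nonneg_left ?_ (pow_nonneg hc _))
      · simpa only [add_assoc, add_comm m] using hD (j + m)
      · rw [hA.tsum_push_mul hg hB.abs_pull_one_le, h0]
      · obtain ⟨w, hw, hwk⟩ := hD 0
        exact hA.tsum_abs_push_mul_le_of_doeblin hε hw (fun x x' => (hwk x x').1)
          (fun x x' => (hwk x x').2) hg hB.abs_pull_one_le
          (hB.pull_nonneg fun _ => zero_le_one) h0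

lemma IsPmf.summable {S : Type*} {p : S → ℝ} (hp : IsPmf p) : Summable p := by
  by_contra h
  have := hp.2
  rw [tsum_eq_zero_of_not_summable h] at this
  exact zero_ne_one this

lemma IsPmf.le_one {S : Type*} {p : S → ℝ} (hp : IsPmf p) (x : S) : p x ≤ 1 :=
  (hp.summable.le_tsum x fun _ _ => hp.1 _).trans_eq hp.2

lemma isSubstochastic_filterKernel {S : Type*} {P : S → U → S → ℝ} {Φ : S → Y → ℝ}
    (hP : ∀ x u, IsPmf (P x u)) (hΦ : ∀ x y, 0 ≤ Φ x y ∧ Φ x y ≤ 1) (y : Y) (u : U) :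
    IsSubstochastic (filterKernel P Φ y u) := by
  have hle : ∀ x x', filterKernel P Φ y u x x' ≤ P x u x' := fun x x' =>
    mul_le_of_le_one_right ((hP x u).1 x') (hΦ x' y).2
  have h0 : ∀ x x', 0 ≤ filterKernel P Φ y u x x' := fun x x' =>
    mul_nonneg ((hP x u).1 x') (hΦ x' y).1
  have hs : ∀ x, Summable (filterKernel P Φ y u x) := fun x =>
    Summable.of_nonneg_of_le (h0 x) (hle x) (hP x u).summable
  exact ⟨h0, hs, fun x => ((hs x).tsum_le_tsum (hle x) (hP x u).summable).trans_eq (hP x u).2⟩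

lemma barBlock_eq (P : X → U → X → ℝ) (Φ : X → Y → ℝ) (μ : U → ℝ) (m : ℕ) (ys : ℕ → Y)
    (us : ℕ → U) (x x' : X) :
    barBlock P Φ μ m x (fun i => ys i) (fun i => us i) x' =
      (∏ i ∈ Finset.range m, μ (us i)) *
        kernelIter (fun i => filterKernel P Φ (ys i) (us i)) m x x' := by
  induction m generalizing ys us x with
  | zero => simp [barBlock, kernelIter]
  | succ m ih =>
    simp only [barBlock, kernelIter, kernelPush]
    rw [← tsum_mul_left]
    refine tsum_congr fun x₁ => ?_
    have h := ih (fun i => ys (i + 1)) (fun i => us (i + 1)) x₁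
    change μ (us 0) * P x (us 0) x₁ * Φ x₁ (ys 0) *
      barBlock P Φ μ m x₁ (fun i => ys (i + 1)) (fun i => us (i + 1)) x' = _
    rw [h, Finset.prod_range_succ']
    simp only [filterKernel]
    ring

lemma exists_backward_eq {P : X → U → X → ℝ} {Φ : X → Y → ℝ} (pol : Y → Z → U → ℝ)
    (φd : Z → Y → U → Z) {us : ℕ → U} {ys : ℕ → Y}
    (hK : ∀ i, IsSubstochastic (filterKernel P Φ (ys i) (us i))) (n : ℕ) (y : Y) (z : Z) :
    ∃ c : ℝ, (c ≠ 0 → ∀ i < n, ∃ y z, pol y z (us i) ≠ 0) ∧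
      ∀ x, backward P Φ pol φd n x y z (fun i => ys i) (fun i => us i) =
        c * kernelPull (kernelIter (fun i => filterKernel P Φ (ys i) (us i)) n) (fun _ => 1) x := by
  induction n generalizing ys us y z with
  | zero => exact ⟨1, by simp, by simp [backward, kernelPull, kernelIter]⟩
  | succ n ih =>
    obtain ⟨c, hc, h⟩ := ih (us := fun i => us (i + 1)) (ys := fun i => ys (i + 1))
      (fun i => hK (i + 1)) (ys 0) (φd z y (us 0))
    refine ⟨pol y z (us 0) * c, fun hne i hi => ?_, fun x => ?_⟩
    · rcases i with _ | i
      · exact ⟨y, z, left_ne_zero_of_mul hne⟩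
      · exact hc (right_ne_zero_of_mul hne) i (by omega)
    · have hp := (hK 0).pull_pull (.iter (fun i => hK (i + 1)) n) (f := fun _ => 1) (C := 1)
        (by simp)
      change pol y z (us 0) * ∑' x₁ : X, P x (us 0) x₁ * Φ x₁ (ys 0) *
        backward P Φ pol φd n x₁ (ys 0) (φd z y (us 0)) (fun i => ys (i + 1))
          (fun i => us (i + 1)) = _
      simp only [kernelIter]
      rw [← hp, mul_assoc]
      congr 1
      simp only [h]
      rw [kernelPull, ← tsum_mul_left]
      exact tsum_congr fun x₁ => by simp only [filterKernel]; ring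

lemma bayesF_eq {S : Type*} (P : S → U → S → ℝ) (Φ : S → Y → ℝ) {b : S → ℝ} {s : ℝ} (hs : s ≠ 0)
    (y : Y) (u : U) :
    bayesF P Φ (fun x => b x / s) y u = fun x => kernelPush b (filterKernel P Φ y u) x /
      ∑' x', kernelPush b (filterKernel P Φ y u) x' := by
  have e : ∀ x, ∑' x', b x' / s * P x' u x * Φ x y =
      kernelPush b (filterKernel P Φ y u) x / s := fun x => by
    rw [kernelPush, ← tsum_div_const]
    exact tsum_congr fun x' => by simp only [filterKernel]; ring
  ext x
  simp only [bayesF, e]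
  rw [tsum_div_const, div_div_div_cancel_right₀ hs]

lemma bayesFilter_eq {P : X → U → X → ℝ} {Φ : X → Y → ℝ} {us : ℕ → U} {ys : ℕ → Y}
    (hK : ∀ i, IsSubstochastic (filterKernel P Φ (ys i) (us i))) (n : ℕ) {b : X → ℝ}
    (hb : Summable b) (hb₀ : ∀ x, 0 ≤ b x) {s : ℝ} (hbs : ∑' x, b x = s) (hs : s ≠ 0)
    (hpos : ∑' x, kernelPush b (kernelIter (fun i => filterKernel P Φ (ys i) (us i)) n) x ≠ 0) :
    bayesFilter P Φ n (fun x => b x / s) (fun i => ys i) (fun i => us i) = fun x =>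
      kernelPush b (kernelIter (fun i => filterKernel P Φ (ys i) (us i)) n) x /
        ∑' x', kernelPush b (kernelIter (fun i => filterKernel P Φ (ys i) (us i)) n) x' := by
  induction n generalizing ys us b s with
  | zero => simp only [bayesFilter, kernelPush_kernelIter_zero, hbs]
  | succ n ih =>
    have hp := (hK 0).push_push (.iter (fun i => hK (i + 1)) n) hb
    simp only [kernelIter] at hpos ⊢
    rw [← hp] at hpos ⊢
    have h₁ := (hK 0).summable_push hb
    have h₁' : ∀ x, 0 ≤ kernelPush b (filterKernel P Φ (ys 0) (us 0)) x := fun x =>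
      tsum_nonneg fun x' => mul_nonneg (hb₀ _) ((hK 0).nonneg _ _)
    change bayesFilter P Φ n (bayesF P Φ (fun x => b x / s) (ys 0) (us 0))
      (fun i => ys (i + 1)) (fun i => us (i + 1)) = _
    rw [bayesF_eq P Φ hs]
    refine ih (us := fun i => us (i + 1)) (ys := fun i => ys (i + 1)) (fun i => hK (i + 1)) h₁ h₁'
      rfl (fun h => hpos ?_) hpos
    have hz : kernelPush b (filterKernel P Φ (ys 0) (us 0)) = 0 :=
      (hasSum_zero_iff_of_nonneg h₁').mp (h ▸ h₁.hasSum)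
    rw [hz]
    simp [kernelPush]

lemma dTV_le_one {S : Type*} {p q : S → ℝ} (hp : IsPmf p) (hq : IsPmf q) : dTV p q ≤ 1 := by
  have h : ∑' x, |p x - q x| ≤ ∑' x, (p x + q x) :=
    (hp.summable.sub hq.summable).abs.tsum_le_tsum (fun x => by
      have := hp.1 x
      have := hq.1 x
      rw [abs_le]; constructor <;> linarith) (hp.summable.add hq.summable)
  rw [hp.summable.tsum_add hq.summable, hp.2, hq.2] at h
  rw [dTV]
  linarith

/-- **Geometric filter stability for POMDPs under an FSC.** Under persistence of
excitation (Condition 1) and minorization–majorization (Condition 2), for any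
two priors `v₀, v₀'` and any realized history `h_n = (h₀, y_1^n, u^{n−1})` of
positive probability, the `n`-step Bayes filters started from the two priors
satisfy
`d_TV(F⁽ⁿ⁾(v₀,…), F⁽ⁿ⁾(v₀',…)) ≤ (1 − (ε₀ α^{m₀−1})²)^{⌊n/m₀⌋} d_TV(φ(v₀,h_n), φ(v₀',h_n)) ≤ (1 − (ε₀ α^{m₀−1})²)^{⌊n/m₀⌋}`. -/
theorem geometric_filter_stability
    {X Y Z U : Type*} [DecidableEq X] [Countable X] [Countable Y] [Finite Z] [Finite U]
    (P : X → U → X → ℝ) (Φ : X → Y → ℝ)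
    (hP : ∀ x u, IsPmf (P x u)) (hΦ : ∀ x, IsPmf (Φ x))
    (polStar : Y → Z → U → ℝ) (hpol : ∀ y z, IsPmf (polStar y z))
    (φd : Z → Y → U → Z)
    (α ε₀ : ℝ) (hα : α ∈ Set.Ioo (0 : ℝ) 1) (hε₀ : ε₀ ∈ Set.Ioo (0 : ℝ) 1)
    (m₀ : ℕ) (hm₀ : 1 ≤ m₀)
    (μbar : U → ℝ) (hμbar : IsPmf μbar)
    -- Condition 1 (persistence of excitation):
    (hPE : ∀ (u : U) (y : Y) (z : Z),
      α * μbar u ≤ polStar y z u ∧ polStar y z u ≤ μbar u / α)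
    (ν : X × (Fin m₀ → Y) × (Fin m₀ → U) → ℝ) (hν : IsPmf ν)
    -- Condition 2 (minorization–majorization):
    (hMM : ∀ (x₀ xm : X) (ys : Fin m₀ → Y) (us : Fin m₀ → U),
      ε₀ * ν (xm, ys, us) ≤ barBlock P Φ μbar m₀ x₀ ys us xm ∧
        barBlock P Φ μbar m₀ x₀ ys us xm ≤ ν (xm, ys, us) / ε₀)
    (n : ℕ) (hn : 1 ≤ n)
    (v₀ v₀' : X → ℝ) (hv₀ : IsPmf v₀) (hv₀' : IsPmf v₀')
    (y₀ : Y) (z₀ : Z) (ys : Fin n → Y) (us : Fin n → U)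
    -- the realized history has positive probability under either prior:
    (hpos : 0 < ∑' x : X, v₀ x * backward P Φ polStar φd n x y₀ z₀ ys us)
    (hpos' : 0 < ∑' x : X, v₀' x * backward P Φ polStar φd n x y₀ z₀ ys us) :
    dTV (bayesFilter P Φ n v₀ ys us) (bayesFilter P Φ n v₀' ys us)
        ≤ (1 - (ε₀ * α ^ (m₀ - 1)) ^ 2) ^ (n / m₀) *
          dTV (initialPosterior P Φ polStar φd n v₀ y₀ z₀ ys us)
              (initialPosterior P Φ polStar φd n v₀' y₀ z₀ ys us)
      ∧ dTV (bayesFilter P Φ n v₀ ys us) (bayesFilter P Φ n v₀' ys us)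
          ≤ (1 - (ε₀ * α ^ (m₀ - 1)) ^ 2) ^ (n / m₀) := by
  obtain ⟨n', rfl⟩ : ∃ n', n = n' + 1 := ⟨n - 1, by omega⟩
  obtain ⟨hα₀, hα₁⟩ := hα
  obtain ⟨hε, hε₁⟩ := hε₀
  obtain ⟨ys, rfl⟩ : ∃ s : ℕ → Y, ys = fun i : Fin (n' + 1) => s i :=
    ⟨fun i => if h : i < n' + 1 then ys ⟨i, h⟩ else y₀, by ext i; beta_reduce; rw [dif_pos i.isLt]⟩
  obtain ⟨us, hus, rfl⟩ : ∃ s : ℕ → U, (∀ i, ∃ j < n' + 1, s i = s j) ∧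
      us = fun i : Fin (n' + 1) => s i := by
    refine ⟨fun i => if h : i < n' + 1 then us ⟨i, h⟩ else us 0, fun i => ?_,
      by ext i; beta_reduce; rw [dif_pos i.isLt]⟩
    by_cases h : i < n' + 1
    · exact ⟨i, h, rfl⟩
    · exact ⟨0, by omega, by simp [h]⟩
  generalize n' + 1 = n at *
  have hK : ∀ i, IsSubstochastic (filterKernel P Φ (ys i) (us i)) := fun i =>
    isSubstochastic_filterKernel hP (fun x y => ⟨(hΦ x).1 y, (hΦ x).le_one y⟩) _ _
  obtain ⟨c, hc, hback⟩ := exists_backward_eq polStar φd hK n y₀ z₀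
  set K : ℕ → X → X → ℝ := fun i => filterKernel P Φ (ys i) (us i)
  have hKn := IsSubstochastic.iter hK n
  set B := kernelPull (kernelIter K n) (fun _ => 1) with hB
  have hB₀ : ∀ x, 0 ≤ B x := hKn.pull_nonneg fun _ => zero_le_one
  have hsum : ∀ v : X → ℝ, ∑' x, v x * backward P Φ polStar φd n x y₀ z₀ (fun i => ys i)
      (fun i => us i) = c * ∑' x, v x * B x := fun v => by
    rw [← tsum_mul_left]
    exact tsum_congr fun x => by rw [hback]; ring
  rw [hsum] at hpos hpos'
  have hc₀ : c ≠ 0 := left_ne_zero_of_mul hpos.ne'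
  have hZ : ∑' x, v₀ x * B x ≠ 0 := right_ne_zero_of_mul hpos.ne'
  have hZ' : ∑' x, v₀' x * B x ≠ 0 := right_ne_zero_of_mul hpos'.ne'
  have hμ : ∀ i, 0 < μbar (us i) := fun i => by
    obtain ⟨j, hj, hij⟩ := hus i
    obtain ⟨y, z, hyz⟩ := hc hc₀ j hj
    rw [hij]
    refine (hμbar.1 _).lt_of_ne' fun h => hyz ?_
    have := (hPE (us j) y z).2
    rw [h, zero_div] at this
    exact le_antisymm this ((hpol y z).1 _)
  have hD : ∀ j, ∃ w : X → ℝ, Summable w ∧ ∀ x x',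
      ε₀ * w x' ≤ kernelIter (fun i => K (i + j)) m₀ x x' ∧
        kernelIter (fun i => K (i + j)) m₀ x x' ≤ w x' / ε₀ := fun j => by
    set M := ∏ i ∈ Finset.range m₀, μbar (us (i + j))
    have hM₀ : 0 < M := Finset.prod_pos fun i _ => hμ _
    refine ⟨fun x => ν (x, (fun i => ys (i + j)), fun i => us (i + j)) / M, ?_, fun x x' => ?_⟩
    · refine Summable.div_const (hν.summable.comp_injective
        (i := fun x => (x, (fun i : Fin m₀ => ys (i + j)), fun i : Fin m₀ => us (i + j)))
        fun a b h => congrArg Prod.fst h) M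
    · have h := hMM x x' (fun i => ys (i + j)) (fun i => us (i + j))
      rw [barBlock_eq P Φ μbar m₀ (fun i => ys (i + j)) (fun i => us (i + j)) x x'] at h
      rw [← mul_div_assoc, div_right_comm, div_le_iff₀' hM₀, le_div_iff₀' hM₀]
      exact h
  have hpost : ∀ v : X → ℝ, initialPosterior P Φ polStar φd n v y₀ z₀ (fun i => ys i)
      (fun i => us i) = fun x => v x * B x / ∑' x', v x' * B x' := fun v => by
    ext x
    rw [initialPosterior, hsum, hback, mul_left_comm, mul_div_mul_left _ _ hc₀]
  have hmass : ∀ v : X → ℝ, Summable v →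
      ∑' x, kernelPush v (kernelIter K n) x = ∑' x, v x * B x := fun v hv => by
    simpa using hKn.tsum_push_mul (f := fun _ => 1) (C := 1) hv (by simp)
  have hfilter : ∀ v : X → ℝ, IsPmf v → ∑' x, v x * B x ≠ 0 →
      bayesFilter P Φ n v (fun i => ys i) (fun i => us i) = fun x =>
        kernelPush v (kernelIter K n) x / ∑' x', v x' * B x' := fun v hv hv' => by
    have h := bayesFilter_eq hK n hv.summable hv.1 hv.2 one_ne_zero
      (by rw [hmass v hv.summable]; exact hv')
    rw [hmass v hv.summable] at h
    simpa only [div_one] using h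
  have hpmf : ∀ v : X → ℝ, IsPmf v → ∑' x, v x * B x ≠ 0 →
      IsPmf fun x => v x * B x / ∑' x', v x' * B x' := fun v hv hv' =>
    ⟨fun x => div_nonneg (mul_nonneg (hv.1 x) (hB₀ x))
      (tsum_nonneg fun x => mul_nonneg (hv.1 x) (hB₀ x)), by rw [tsum_div_const, div_self hv']⟩
  rw [hpost, hpost, hfilter v₀ hv₀ hZ, hfilter v₀' hv₀' hZ']
  have hp := hpmf v₀ hv₀ hZ
  have hp' := hpmf v₀' hv₀' hZ'
  set S := ∑' x, v₀ x * B x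
  set S' := ∑' x, v₀' x * B x
  set g : X → ℝ := fun x => v₀ x / S - v₀' x / S' with hgdef
  have hg : Summable g := (hv₀.summable.div_const _).sub (hv₀'.summable.div_const _)
  have hgB : ∀ x, g x * B x = v₀ x * B x / S - v₀' x * B x / S' := fun x => by
    simp only [hgdef]; ring
  have hg₀ : ∑' x, g x * B x = 0 := by
    simp only [hgB]
    rw [hp.summable.tsum_sub hp'.summable, hp.2, hp'.2, sub_self]
  have hgpush : ∀ x, kernelPush g (kernelIter K n) x =
      kernelPush v₀ (kernelIter K n) x / S - kernelPush v₀' (kernelIter K n) x / S' := fun x => by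
    have hs : ∀ v : X → ℝ, IsPmf v → Summable fun x₁ => v x₁ * kernelIter K n x₁ x := fun v hv =>
      Summable.of_nonneg_of_le (fun x₁ => mul_nonneg (hv.1 _) (hKn.nonneg _ _))
        (fun x₁ => mul_le_of_le_one_right (hv.1 _) (hKn.le_one _ _)) hv.summable
    simp only [kernelPush]
    rw [← tsum_div_const, ← tsum_div_const,
      ← ((hs v₀ hv₀).div_const S).tsum_sub ((hs v₀' hv₀').div_const S')]
    exact tsum_congr fun x₁ => by simp only [hgdef]; ring
  have hmain := tsum_abs_push_iter_le (K := K) hK hε hε₁.le hm₀ hD n hg hg₀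
  have hgabs : ∀ x, |g x| * B x = |v₀ x * B x / S - v₀' x * B x / S'| := fun x => by
    rw [← hgB, abs_mul, abs_of_nonneg (hB₀ x)]
  simp only [hgpush, ← hB, hgabs] at hmain
  have hrate : (1 - ε₀ ^ 2) ^ (n / m₀) ≤ (1 - (ε₀ * α ^ (m₀ - 1)) ^ 2) ^ (n / m₀) := by
    have h₁ : ε₀ * α ^ (m₀ - 1) ≤ ε₀ := mul_le_of_le_one_right hε.le (pow_le_one₀ hα₀.le hα₁.le)
    have h₂ : (ε₀ * α ^ (m₀ - 1)) ^ 2 ≤ ε₀ ^ 2 := pow_le_pow_left₀ (by positivity) h₁ 2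
    exact pow_le_pow_left₀ (by nlinarith) (by linarith) _
  have hrate₀ : 0 ≤ (1 - (ε₀ * α ^ (m₀ - 1)) ^ 2) ^ (n / m₀) :=
    (pow_nonneg (by nlinarith) _).trans hrate
  have hfirst : dTV (fun x => kernelPush v₀ (kernelIter K n) x / S)
      (fun x => kernelPush v₀' (kernelIter K n) x / S') ≤
      (1 - (ε₀ * α ^ (m₀ - 1)) ^ 2) ^ (n / m₀) *
        dTV (fun x => v₀ x * B x / S) (fun x => v₀' x * B x / S') := by
    simp only [dTV, ← mul_div_assoc]
    refine div_le_div_of_nonneg_right (hmain.trans ?_) zero_le_two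
    exact mul_le_mul_of_nonneg_right hrate (tsum_nonneg fun _ => abs_nonneg _)
  exact ⟨hfirst, hfirst.trans (mul_le_of_le_one_right hrate₀ (dTV_le_one hp hp'))⟩
end
end
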